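/- arXiv:2302.12408 — 2 statements merged into one kernel-verified Lean document; each statement's English description precedes it below -/
import Mathlib

section
/- If κ is an infinite cardinal with 2^κ < ℵ_κ and cf(κ) > ω, then there exists a topological space X which is locally compact and T₄ (normal Hausdorff), such that o(X) = 2^(ℵ_κ) = |X|, ℵ_κ is a caliber* for X, ℵ_κ is not a weak precaliber for X, and κ is not a weak precaliber* for X. -/
open Cardinal Set

universe u

/-- `κ` is a caliber for `X`: every κ-indexed family of non-empty open sets
(repetitions allowed) has a κ-sized subfamily with non-empty intersection. -/
def IsCaliber (X : Type u) [TopologicalSpace X] (κ : Cardinal.{u}) : Prop :=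
  ∀ {ι : Type u} (U : ι → Set X), #ι = κ → (∀ i, IsOpen (U i)) → (∀ i, (U i).Nonempty) →
    ∃ J : Set ι, #J = κ ∧ (⋂ i ∈ J, U i).Nonempty

/-- `κ` is a precaliber for `X`: every κ-indexed family of non-empty open sets
has a κ-sized subfamily which is centered. -/
def IsPrecaliber (X : Type u) [TopologicalSpace X] (κ : Cardinal.{u}) : Prop :=
  ∀ {ι : Type u} (U : ι → Set X), #ι = κ → (∀ i, IsOpen (U i)) → (∀ i, (U i).Nonempty) →
    ∃ J : Set ι, #J = κ ∧
      ∀ s : Finset ι, ↑s ⊆ J → s.Nonempty → (⋂ i ∈ s, U i).Nonempty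

/-- `κ` is a weak precaliber for `X`: every κ-indexed family of non-empty open sets
has a κ-sized subfamily which is linked. -/
def IsWeakPrecaliber (X : Type u) [TopologicalSpace X] (κ : Cardinal.{u}) : Prop :=
  ∀ {ι : Type u} (U : ι → Set X), #ι = κ → (∀ i, IsOpen (U i)) → (∀ i, (U i).Nonempty) →
    ∃ J : Set ι, #J = κ ∧ ∀ i ∈ J, ∀ j ∈ J, (U i ∩ U j).Nonempty

/-- `κ` is a caliber* for `X`: every family of non-empty open sets of cardinality `κ`
has a subfamily of cardinality `κ` with non-empty intersection. -/
def IsCaliberStar (X : Type u) [TopologicalSpace X] (κ : Cardinal.{u}) : Prop :=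
  ∀ 𝒰 : Set (Set X), #𝒰 = κ → (∀ U ∈ 𝒰, IsOpen U) → (∀ U ∈ 𝒰, U.Nonempty) →
    ∃ 𝒱 ⊆ 𝒰, #𝒱 = κ ∧ (⋂₀ 𝒱).Nonempty

/-- `κ` is a precaliber* for `X`: every family of non-empty open sets of cardinality `κ`
has a centered subfamily of cardinality `κ`. -/
def IsPrecaliberStar (X : Type u) [TopologicalSpace X] (κ : Cardinal.{u}) : Prop :=
  ∀ 𝒰 : Set (Set X), #𝒰 = κ → (∀ U ∈ 𝒰, IsOpen U) → (∀ U ∈ 𝒰, U.Nonempty) →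
    ∃ 𝒱 ⊆ 𝒰, #𝒱 = κ ∧
      ∀ s : Finset (Set X), ↑s ⊆ 𝒱 → s.Nonempty → (⋂₀ (↑s : Set (Set X))).Nonempty

/-- `κ` is a weak precaliber* for `X`: every family of non-empty open sets of
cardinality `κ` has a linked subfamily of cardinality `κ`. -/
def IsWeakPrecaliberStar (X : Type u) [TopologicalSpace X] (κ : Cardinal.{u}) : Prop :=
  ∀ 𝒰 : Set (Set X), #𝒰 = κ → (∀ U ∈ 𝒰, IsOpen U) → (∀ U ∈ 𝒰, U.Nonempty) →
    ∃ 𝒱 ⊆ 𝒰, #𝒱 = κ ∧ ∀ U ∈ 𝒱, ∀ V ∈ 𝒱, (U ∩ V).Nonempty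

/-- `o X` : the number of open subsets of `X`. -/
def oCard (X : Type u) [TopologicalSpace X] : Cardinal.{u} :=
  #{U : Set X | IsOpen U}

/-- A cellular family: a pairwise disjoint collection of non-empty open sets. -/
def IsCellularFamily (X : Type u) [TopologicalSpace X] (𝒰 : Set (Set X)) : Prop :=
  (∀ U ∈ 𝒰, IsOpen U) ∧ (∀ U ∈ 𝒰, U.Nonempty) ∧ 𝒰.Pairwise Disjoint

theorem exists_maximal_pairwiseDisjoint {ι β : Type*} [PartialOrder β] [OrderBot β]
    (t : ι → β) (T : Set ι) :
    ∃ J ⊆ T, J.PairwiseDisjoint t ∧ ∀ i ∈ T, i ∈ J ∨ ∃ j ∈ J, ¬ Disjoint (t i) (t j) := by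
  obtain ⟨J, hJ⟩ := zorn_subset {J : Set ι | J ⊆ T ∧ J.PairwiseDisjoint t} (by
    intro c hc hchain
    refine ⟨⋃₀ c, ⟨sUnion_subset fun s hs => (hc hs).1, ?_⟩, fun s hs => subset_sUnion_of_mem hs⟩
    exact (pairwiseDisjoint_sUnion hchain.directedOn).2 fun s hs => (hc hs).2)
  refine ⟨J, hJ.prop.1, hJ.prop.2, fun i hi => ?_⟩
  by_contra! h
  refine h.1 (hJ.le_of_ge (y := insert i J) ⟨insert_subset hi hJ.prop.1, ?_⟩
    (subset_insert i J) (mem_insert i J))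
  exact (pairwiseDisjoint_insert_of_notMem h.1).2 ⟨hJ.prop.2, h.2⟩

theorem mk_biUnion_finset_lt {ι I : Type u} {θ : Cardinal.{u}} (hθ : ℵ₀ < θ)
    (s : ι → Finset I) (J : Set ι) (hJ : #J < θ) : #(⋃ i ∈ J, (s i : Set I)) < θ := by
  refine (mk_biUnion_le _ _).trans_lt (mul_lt_of_lt hθ.le hJ (lt_of_le_of_lt ?_ hθ))
  exact ciSup_le' fun i => (finset_card_lt_aleph0 (s i)).le

theorem mk_le_of_pairwiseDisjoint {ι I : Type u} (t : ι → Set I) (A : Set ι) (S : Set I)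
    (hA : A.PairwiseDisjoint t) (h : ∀ i ∈ A, (t i ∩ S).Nonempty) : #A ≤ #S := by
  choose f hf using fun i : A => h i i.2
  refine mk_le_of_injective (f := fun i : A => (⟨f i, (hf i).2⟩ : S)) fun i j hij => ?_
  have hij : f i = f j := congrArg Subtype.val hij
  by_contra hne
  refine (hA i.2 j.2 fun h => hne (Subtype.ext h)).notMem_of_mem_left (hf i).1 ?_
  rw [hij]
  exact (hf j).1

/-- The delta-system lemma for sets of bounded finite size. -/
theorem exists_delta_system_of_card_le {ι I : Type u} {θ : Cardinal.{u}} (hreg : θ.IsRegular)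
    (hθ : ℵ₀ < θ) (n : ℕ) (s : ι → Finset I) (T : Set ι) (hT : #T = θ)
    (hs : ∀ i ∈ T, (s i).card ≤ n) :
    ∃ R : Finset I, ∃ J ⊆ T, #J = θ ∧ J.PairwiseDisjoint fun i => (s i : Set I) \ R := by
  classical
  induction n generalizing s T with
  | zero =>
    refine ⟨∅, T, Subset.rfl, hT, fun i hi j hj _ => ?_⟩
    have : s i = ∅ := by simpa using hs i hi
    simp [Function.onFun, this]
  | succ n ih =>
    obtain ⟨J, hJT, hJ, hmax⟩ := exists_maximal_pairwiseDisjoint (fun i => (s i : Set I)) T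
    rcases (hT ▸ mk_le_mk_of_subset hJT : #J ≤ θ).eq_or_lt with hcard | hcard
    · exact ⟨∅, J, hJT, hcard, by simpa using hJ⟩
    have hS := mk_biUnion_finset_lt hθ s J hcard
    obtain ⟨c, hc⟩ : ∃ c, θ ≤ #{i ∈ T | c ∈ s i} := by
      by_contra! hlt
      have hsub : T ⊆ J ∪ ⋃ c ∈ ⋃ i ∈ J, (s i : Set I), {i ∈ T | c ∈ s i} := by
        intro i hi
        refine (hmax i hi).imp id fun ⟨j, hj, hij⟩ => ?_
        obtain ⟨c, hci, hcj⟩ := not_disjoint_iff.1 hij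
        exact mem_biUnion (mem_biUnion hj hcj) ⟨hi, hci⟩
      refine (mk_le_mk_of_subset hsub).not_gt (hT.symm ▸ (mk_union_le _ _).trans_lt ?_)
      exact add_lt_of_lt hθ.le hcard
        ((card_biUnion_lt_iff_forall_of_isRegular hreg hS).2 fun c _ => hlt c)
    have hc : #{i ∈ T | c ∈ s i} = θ :=
      le_antisymm (hT ▸ mk_le_mk_of_subset (sep_subset _ _)) hc
    obtain ⟨R, K, hK, hKcard, hKdisj⟩ := ih (fun i => (s i).erase c) _ hc fun i hi => by
      have := hs i hi.1
      rw [Finset.card_erase_of_mem hi.2]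
      omega
    refine ⟨insert c R, K, hK.trans (sep_subset _ _), hKcard, ?_⟩
    convert hKdisj using 2 with i
    ext a
    simp
    tauto

theorem exists_delta_system {ι I : Type u} {θ : Cardinal.{u}} (hreg : θ.IsRegular)
    (hθ : ℵ₀ < θ) (s : ι → Finset I) (x : ι → I → Bool) (T : Set ι) (hT : #T = θ) :
    ∃ (R : Finset I) (z : I → Bool), ∃ J ⊆ T, #J = θ ∧
      (∀ i ∈ J, ∀ c ∈ R, x i c = z c) ∧ J.PairwiseDisjoint fun i => (s i : Set I) \ R := by
  classical
  obtain ⟨⟨n⟩, T₁, hT₁, hle, hn⟩ := infinite_pigeonhole_set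
    (fun i : T => (ULift.up (s i).card : ULift.{u} ℕ)) θ hT.ge hθ.le
    (by rw [hreg.cof_ord]; simpa using hθ)
  have hT₁θ : #T₁ = θ := le_antisymm (hT ▸ mk_le_mk_of_subset hT₁) hle
  obtain ⟨R, T₂, hT₂, hT₂θ, hdisj⟩ := exists_delta_system_of_card_le hreg hθ n s T₁ hT₁θ
    fun i hi => (congrArg ULift.down (hn hi)).le
  obtain ⟨z, J, hJ, hle, hz⟩ := infinite_pigeonhole_set
    (fun (i : T₂) (c : R) => x i c) θ hT₂θ.ge hθ.le
    (by rw [hreg.cof_ord]; exact (lt_aleph0_of_finite _).trans hθ)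
  refine ⟨R, fun c => if h : c ∈ R then z ⟨c, h⟩ else false, J, hJ.trans (hT₂.trans hT₁),
    le_antisymm (hT₂θ ▸ mk_le_mk_of_subset hJ) hle, fun i hi c hc => ?_, hdisj.subset hJ⟩
  simpa [hc] using congrFun (hz hi) ⟨c, hc⟩

theorem exists_common_extension {ι I : Type*} (s : ι → Finset I) (x : ι → I → Bool) (J : Set ι)
    (R : Set I) (r : I → Bool) (hJ : J.PairwiseDisjoint fun i => (s i : Set I) \ R)
    (hr : ∀ i ∈ J, ∀ c ∈ s i, c ∈ R → x i c = r c) :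
    ∃ z : I → Bool, ∀ i ∈ J, ∀ c ∈ s i, x i c = z c := by
  classical
  refine ⟨fun c => if c ∈ R then r c else
    if h : ∃ i ∈ J, c ∈ s i then x h.choose c else false, fun i hi c hc => ?_⟩
  by_cases hcR : c ∈ R
  · simpa [hcR] using hr i hi c hc hcR
  · have h : ∃ i ∈ J, c ∈ s i := ⟨i, hi, hc⟩
    have heq : i = h.choose := by
      by_contra hne
      exact (hJ hi h.choose_spec.1 hne).notMem_of_mem_left ⟨hc, hcR⟩ ⟨h.choose_spec.2, hcR⟩
    simp only [hcR, if_false, dif_pos h]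
    rw [← heq]

theorem exists_common_extension_of_isRegular {ι I : Type u} {θ : Cardinal.{u}}
    (hreg : θ.IsRegular) (hθ : ℵ₀ < θ) (s : ι → Finset I) (x : ι → I → Bool) (hι : #ι = θ) :
    ∃ (J : Set ι) (z : I → Bool), #J = θ ∧ ∀ i ∈ J, ∀ c ∈ s i, x i c = z c := by
  obtain ⟨R, r, J, -, hJθ, hr, hdisj⟩ :=
    exists_delta_system hreg hθ s x univ (mk_univ.trans hι)
  obtain ⟨z, hz⟩ := exists_common_extension s x J R r hdisj fun i hi c _ hc => hr i hi c hc
  exact ⟨J, z, hJθ, hz⟩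

/-- A version of `exists_common_extension_of_isRegular` for a singular cardinal `l` approximated by
regular cardinals `θ m`, where `m` ranges over a set of regular uncountable size. -/
theorem exists_common_extension_of_approx {ι I M : Type u} {l : Cardinal.{u}}
    (hM : (#M).IsRegular) (hM' : ℵ₀ < #M) (θ : M → Cardinal.{u}) (hreg : ∀ m, (θ m).IsRegular)
    (hlt : ∀ m, #M < θ m) (hle : ∀ m, θ m ≤ l) (hcof : ∀ ν < l, #{m | θ m ≤ ν} < #M)
    (s : ι → Finset I) (x : ι → I → Bool) (hι : #ι = l) :
    ∃ (J : Set ι) (z : I → Bool), #J = l ∧ ∀ i ∈ J, ∀ c ∈ s i, x i c = z c := by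
  have hA (m : M) : ∃ (R : Finset I) (z : I → Bool), ∃ A : Set ι, #A = θ m ∧
      (∀ i ∈ A, ∀ c ∈ R, x i c = z c) ∧ A.PairwiseDisjoint fun i => (s i : Set I) \ R := by
    obtain ⟨T, hT⟩ := le_mk_iff_exists_set.1 (hι ▸ hle m)
    obtain ⟨R, z, A, -, h⟩ := exists_delta_system (hreg m) (hM'.trans (hlt m)) s x T hT
    exact ⟨R, z, A, h⟩
  choose R z A hAθ hAz hAdisj using hA
  obtain ⟨Ξ, r, hΞ, hr⟩ := exists_common_extension_of_isRegular hM hM' R z rfl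
  set Q : Set I := ⋃ m ∈ Ξ, (R m : Set I)
  obtain ⟨J, hJB, hJdisj, hJmax⟩ := exists_maximal_pairwiseDisjoint
    (fun i => (s i : Set I) \ Q)
    (⋃ m ∈ Ξ, {i ∈ A m | Disjoint ((s i : Set I) \ R m) Q})
  obtain ⟨y, hy⟩ := exists_common_extension s x J Q r hJdisj (by
    intro i hi c hc hcQ
    obtain ⟨m, hm, hiA, hid⟩ := mem_iUnion₂.1 (hJB hi)
    have hcR : c ∈ R m := by
      by_contra hcR
      exact hid.notMem_of_mem_left ⟨hc, hcR⟩ hcQ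
    rw [hAz m i hiA c hcR, hr m hm c hcR])
  refine ⟨J, y, ?_, hy⟩
  refine (hι ▸ mk_set_le J : #J ≤ l).eq_of_not_lt fun hJl => ?_
  obtain ⟨m, hm, hmJ⟩ : ∃ m ∈ Ξ, #J < θ m := by
    by_contra! h
    exact (hcof _ hJl).not_ge (hΞ ▸ mk_le_mk_of_subset h)
  have hθ := hM'.trans (hlt m)
  have hcard := (mk_union_le Q (⋃ i ∈ J, (s i : Set I))).trans_lt (add_lt_of_lt hθ.le
    (mk_biUnion_finset_lt hθ R Ξ (hΞ ▸ hlt m)) (mk_biUnion_finset_lt hθ s J hmJ))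
  have hdiff := mk_le_of_pairwiseDisjoint _ (A m \ J) (Q ∪ ⋃ i ∈ J, (s i : Set I))
    ((hAdisj m).subset sdiff_subset) (by
      rintro i ⟨hiA, hiJ⟩
      by_cases hd : Disjoint ((s i : Set I) \ R m) Q
      · obtain ⟨j, hj, hij⟩ := (hJmax i (mem_biUnion hm ⟨hiA, hd⟩)).resolve_left hiJ
        obtain ⟨c, ⟨hci, hcQ⟩, hcj, -⟩ := not_disjoint_iff.1 hij
        exact ⟨c, ⟨hci, fun hcR => hcQ (mem_biUnion hm hcR)⟩, Or.inr (mem_biUnion hj hcj)⟩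
      · obtain ⟨c, hc, hcQ⟩ := not_disjoint_iff.1 hd
        exact ⟨c, hc, Or.inl hcQ⟩)
  refine (le_mk_sdiff_add_mk (A m) J).not_gt ?_
  rw [hAθ m]
  exact add_lt_of_lt hθ.le (hdiff.trans_lt hcard) hmJ

theorem exists_finset_forall_eq_imp_mem {I : Type*} {U : Set (I → Bool)} (hU : IsOpen U)
    {x : I → Bool} (hx : x ∈ U) : ∃ s : Finset I, ∀ y : I → Bool, (∀ c ∈ s, x c = y c) → y ∈ U := by
  obtain ⟨s, u, hu, hsub⟩ := isOpen_pi_iff.1 hU x hx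
  exact ⟨s, fun y hy => hsub fun c hc => hy c hc ▸ (hu c hc).2⟩

theorem isCaliber_cantor_cube {κ : Cardinal.{u}} (hκ : ℵ₀ ≤ κ) (h1 : κ < Cardinal.aleph κ.ord)
    (h2 : ℵ₀ < κ.ord.cof) (I : Type u) : IsCaliber (I → Bool) (Cardinal.aleph κ.ord) := by
  intro ι U hι hU hne
  choose x hx using hne
  choose s hs using fun i => exists_finset_forall_eq_imp_mem (hU i) (hx i)
  have hlim : Order.IsSuccLimit κ.ord := isSuccLimit_ord hκ
  obtain ⟨S, hS, hS'⟩ := Ordinal.exists_ord_cof_eq κ.ord.ToType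
  rw [Ordinal.cof_toType] at hS'
  have hcard : #S = κ.ord.cof := by simpa using congrArg Ordinal.card hS'
  obtain ⟨J, z, hJ, hz⟩ := exists_common_extension_of_approx (M := S) (l := Cardinal.aleph κ.ord)
    (hcard ▸ isRegular_cof hlim) (hcard ▸ h2)
    (fun m => Order.succ (max κ (Cardinal.aleph
      (Ordinal.typein (α := κ.ord.ToType) (fun a b => a < b) m.1))))
    (fun m => isRegular_succ (hκ.trans (le_max_left _ _)))
    (fun m => Order.lt_succ_of_le
      ((hcard.trans_le (Ordinal.cof_ord_le κ)).trans (le_max_left _ _)))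
    (fun m => Order.succ_le_of_lt (max_lt h1 (aleph_lt_aleph.2 (Ordinal.typein_lt_self m.1))))
    (by
      intro ν hν
      obtain ⟨β, hβ, hνβ⟩ := (isNormal_aleph.lt_iff_exists_lt hlim).1 hν
      obtain ⟨b, rfl⟩ := (Ordinal.mem_range_typein_iff (α := κ.ord.ToType) (fun a b => a < b)).2
        (by simpa using hβ)
      obtain ⟨m, hm, hbm⟩ := hS b
      refine (mk_le_mk_of_subset ?_).trans_lt (mk_Iio_lt (⟨m, hm⟩ : S) (by rw [hS', hcard]))
      intro m' hm'
      have hlt := (le_max_right κ _).trans_lt ((Order.lt_succ _).trans_le hm') |>.trans hνβ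
      rw [aleph_lt_aleph, Ordinal.typein_lt_typein] at hlt
      exact hlt.trans_le hbm)
    s x hι
  exact ⟨J, hJ, z, mem_iInter₂.2 fun i hi => hs i z (hz i hi)⟩

theorem normalSpace_sum_discrete (Y D : Type*) [TopologicalSpace Y] [NormalSpace Y]
    [TopologicalSpace D] [DiscreteTopology D] : NormalSpace (Y ⊕ D) where
  normal s t hs ht hst := by
    obtain ⟨U, V, hU, hV, hsU, htV, hUV⟩ := normal_separation
      (hs.preimage continuous_inl) (ht.preimage continuous_inl) (hst.preimage Sum.inl)
    refine ⟨Sum.inl '' U ∪ Sum.inr '' (Sum.inr ⁻¹' s), Sum.inl '' V ∪ Sum.inr '' (Sum.inr ⁻¹' t),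
      (isOpenMap_inl _ hU).union (isOpenMap_inr _ (isOpen_discrete _)),
      (isOpenMap_inl _ hV).union (isOpenMap_inr _ (isOpen_discrete _)), ?_, ?_, ?_⟩
    · rintro (y | d) h
      · exact Or.inl ⟨y, hsU h, rfl⟩
      · exact Or.inr ⟨d, h, rfl⟩
    · rintro (y | d) h
      · exact Or.inl ⟨y, htV h, rfl⟩
      · exact Or.inr ⟨d, h, rfl⟩
    · rw [Set.disjoint_left] at hUV hst ⊢
      rintro (y | d) h h'
      · exact hUV (a := y) (by simpa using h) (by simpa using h')
      · exact hst (a := .inr d) (by simpa using h) (by simpa using h')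

theorem weaklyLocallyCompactSpace_sum_discrete (Y D : Type*) [TopologicalSpace Y]
    [CompactSpace Y] [TopologicalSpace D] [DiscreteTopology D] :
    WeaklyLocallyCompactSpace (Y ⊕ D) where
  exists_compact_mem_nhds x := by
    rcases x with y | d
    · exact ⟨range Sum.inl, isCompact_range continuous_inl,
        isOpen_range_inl.mem_nhds (mem_range_self y)⟩
    · refine ⟨Sum.inr '' {d}, isCompact_singleton.image continuous_inr,
        (isOpenMap_inr _ (isOpen_discrete _)).mem_nhds (mem_image_of_mem _ rfl)⟩

theorem mk_isOpen_cantor_cube_le (I : Type u) [Infinite I] :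
    #{U : Set (I → Bool) | IsOpen U} ≤ 2 ^ #I := by
  classical
  let B (p : Finset I × Finset I) : Set (I → Bool) := {y | ∀ c ∈ p.1, decide (c ∈ p.2) = y c}
  have hinj : Function.Injective
      fun U : {U : Set (I → Bool) | IsOpen U} => {p | B p ⊆ U.1} := by
    have key (U V : {U : Set (I → Bool) | IsOpen U}) (h : {p | B p ⊆ U.1} = {p | B p ⊆ V.1}) :
        U.1 ⊆ V.1 := by
      intro x hx
      obtain ⟨s, hs⟩ := exists_finset_forall_eq_imp_mem U.2 hx
      have hp : (s, s.filter fun c => x c) ∈ {p | B p ⊆ U.1} := by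
        refine fun y hy => hs y fun c hc => ?_
        rw [← hy c hc]
        simp [show c ∈ s from hc]
      rw [h] at hp
      refine hp fun c hc => ?_
      simp [show c ∈ s from hc]
    exact fun U V h => Subtype.ext ((key U V h).antisymm (key V U h.symm))
  refine (mk_le_of_injective hinj).trans_eq ?_
  rw [mk_set, ← mul_def, mk_finset_of_infinite,
    mul_eq_self (aleph0_le_mk I)]

theorem oCard_sum_le (Y D : Type u) [TopologicalSpace Y] [TopologicalSpace D] :
    oCard (Y ⊕ D) ≤ oCard Y * 2 ^ #D := by
  rw [← mk_set, oCard, oCard, ← lift_id #{U : Set Y | IsOpen U}, ← lift_id #(Set D), ← mk_prod]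
  refine mk_le_of_injective (f := fun U : {U : Set (Y ⊕ D) | IsOpen U} =>
    ((⟨Sum.inl ⁻¹' U.1, U.2.preimage continuous_inl⟩ : {U : Set Y | IsOpen U}),
      Sum.inr ⁻¹' U.1)) fun U V h => Subtype.ext ?_
  simp only [Prod.mk.injEq, Subtype.mk.injEq] at h
  ext (y | d)
  · exact Set.ext_iff.1 h.1 y
  · exact Set.ext_iff.1 h.2 d

theorem mk_le_oCard (X : Type u) [TopologicalSpace X] [T1Space X] : #X ≤ oCard X :=
  mk_le_of_injective (f := fun x : X => (⟨{x}ᶜ, isOpen_compl_singleton⟩ : {U : Set X | IsOpen U}))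
    fun x y h => by simpa using congrArg Subtype.val h

theorem isCaliberStar_sum_of_isCaliber {Y D : Type u} [TopologicalSpace Y] [TopologicalSpace D]
    {l : Cardinal.{u}} (hl : ℵ₀ ≤ l) (hY : IsCaliber Y l) (hD : 2 ^ #D < l) :
    IsCaliberStar (Y ⊕ D) l := by
  intro 𝒰 h𝒰 hopen hne
  set 𝒲 : Set (Set (Y ⊕ D)) := {U ∈ 𝒰 | (Sum.inl ⁻¹' U).Nonempty}
  have hrest : #(𝒰 \ 𝒲 : Set (Set (Y ⊕ D))) < l := by
    refine lt_of_le_of_lt ?_ hD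
    rw [← mk_set]
    refine mk_le_of_injective (f := fun U : (𝒰 \ 𝒲 : Set (Set (Y ⊕ D))) => Sum.inr ⁻¹' U.1)
      fun U V h => Subtype.ext ?_
    have hemp (W : (𝒰 \ 𝒲 : Set (Set (Y ⊕ D)))) (y : Y) : .inl y ∉ W.1 :=
      fun hy => W.2.2 ⟨W.2.1, y, hy⟩
    ext (y | d)
    · exact iff_of_false (hemp U y) (hemp V y)
    · exact Set.ext_iff.1 h d
  have hcard : #𝒲 = l := by
    refine (h𝒰 ▸ mk_le_mk_of_subset (sep_subset _ _) : #𝒲 ≤ l).eq_of_not_lt fun hlt => ?_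
    exact (le_mk_sdiff_add_mk 𝒰 𝒲).not_gt (h𝒰.symm ▸ add_lt_of_lt hl hrest hlt)
  obtain ⟨J, hJ, y, hy⟩ := hY (fun U : 𝒲 => Sum.inl ⁻¹' U.1) hcard
    (fun U => (hopen _ U.2.1).preimage continuous_inl) fun U => U.2.2
  refine ⟨Subtype.val '' J, ?_, ?_, .inl y, ?_⟩
  · rintro _ ⟨U, -, rfl⟩
    exact U.2.1
  · rw [mk_image_eq Subtype.val_injective, hJ]
  · rintro _ ⟨U, hU, rfl⟩
    exact mem_iInter₂.1 hy U hU

theorem not_isWeakPrecaliberStar_sum_discrete (Y D : Type u) [TopologicalSpace Y]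
    [TopologicalSpace D] [DiscreteTopology D] (hD : ℵ₀ ≤ #D) :
    ¬ IsWeakPrecaliberStar (Y ⊕ D) #D := by
  intro h
  obtain ⟨𝒱, h𝒱, hcard, hlink⟩ := h (range fun d : D => ({.inr d} : Set (Y ⊕ D)))
    (mk_range_eq _ fun d e h => by simpa using h)
    (by
      rintro _ ⟨d, rfl⟩
      simpa using isOpenMap_inr (X := Y) _ (isOpen_discrete ({d} : Set D)))
    (by
      rintro _ ⟨d, rfl⟩
      exact singleton_nonempty _)
  have hsub : 𝒱.Subsingleton := by
    intro U hU V hV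
    have := hlink U hU V hV
    obtain ⟨d, rfl⟩ := h𝒱 hU
    obtain ⟨e, rfl⟩ := h𝒱 hV
    obtain rfl : e = d := by simpa using this
    rfl
  exact (hD.trans_eq hcard.symm).not_gt ((mk_le_one_iff_set_subsingleton.2 hsub).trans_lt
    one_lt_aleph0)

theorem not_isWeakPrecaliber_sum_discrete (Y D : Type u) [TopologicalSpace Y]
    [TopologicalSpace D] [DiscreteTopology D] {l : Cardinal.{u}} (θ : D → Cardinal.{u})
    (hθ : ∀ d, θ d < l) (hl : l ≠ 0) (hsum : sum θ = l) :
    ¬ IsWeakPrecaliber (Y ⊕ D) l := by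
  intro h
  obtain ⟨J, hJ, hlink⟩ := h (ι := Σ d, (θ d).out)
    (fun i => ({.inr i.1} : Set (Y ⊕ D))) (by simp [hsum])
    (fun i => by simpa using isOpenMap_inr (X := Y) _ (isOpen_discrete ({i.1} : Set D)))
    fun i => singleton_nonempty _
  rcases J.eq_empty_or_nonempty with rfl | ⟨i, hi⟩
  · exact hl (by simpa using hJ.symm)
  · have hsub : J ⊆ range (Sigma.mk i.1) := by
      intro j hj
      have : j.1 = i.1 := by simpa using hlink i hi j hj
      obtain ⟨d, a⟩ := j
      obtain rfl : d = i.1 := this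
      exact ⟨a, rfl⟩
    refine ((hJ ▸ mk_le_mk_of_subset hsub : l ≤ _).trans mk_range_le).not_gt ?_
    simpa using hθ i.1

theorem sum_aleph_typein {κ : Cardinal.{u}} (hκ : ℵ₀ ≤ κ) :
    sum (fun a : κ.ord.ToType => Cardinal.aleph
      (Ordinal.typein (α := κ.ord.ToType) (fun a b => a < b) a)) = Cardinal.aleph κ.ord := by
  apply le_antisymm
  · refine (sum_le_sum _ (fun _ => Cardinal.aleph κ.ord) fun a =>
      (aleph_lt_aleph.2 (Ordinal.typein_lt_self a)).le).trans ?_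
    rw [sum_const', mk_ord_toType]
    exact mul_le_of_le (aleph0_le_aleph _) (le_aleph_ord κ) le_rfl
  · refine le_of_forall_lt fun ν hν => ?_
    obtain ⟨β, hβ, hνβ⟩ := (isNormal_aleph.lt_iff_exists_lt (isSuccLimit_ord hκ)).1 hν
    obtain ⟨b, rfl⟩ := (Ordinal.mem_range_typein_iff (α := κ.ord.ToType) (fun a b => a < b)).2
      (by simpa using hβ)
    exact hνβ.trans_le (le_sum (fun a : κ.ord.ToType => Cardinal.aleph
      (Ordinal.typein (α := κ.ord.ToType) (fun a b => a < b) a)) b)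

theorem stmt5 (κ : Cardinal.{u}) (hκ : ℵ₀ ≤ κ)
    (h1 : 2 ^ κ < Cardinal.aleph κ.ord) (h2 : ℵ₀ < κ.ord.cof) :
    ∃ (X : Type u) (_ : TopologicalSpace X),
      LocallyCompactSpace X ∧ T4Space X ∧
      oCard X = 2 ^ Cardinal.aleph κ.ord ∧ #X = 2 ^ Cardinal.aleph κ.ord ∧
      IsCaliberStar X (Cardinal.aleph κ.ord) ∧
      ¬ IsWeakPrecaliber X (Cardinal.aleph κ.ord) ∧
      ¬ IsWeakPrecaliberStar X κ := by
  have hκl : κ < Cardinal.aleph κ.ord := (cantor κ).trans h1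
  have hl : ℵ₀ ≤ Cardinal.aleph κ.ord := aleph0_le_aleph _
  let D := κ.ord.ToType
  let I := (Cardinal.aleph κ.ord).out
  have hD : #D = κ := mk_ord_toType κ
  have hI : #I = Cardinal.aleph κ.ord := mk_out _
  have : Infinite I := infinite_iff.2 (hI ▸ hl)
  let _ : TopologicalSpace D := ⊥
  have : DiscreteTopology D := ⟨rfl⟩
  have hpow : (2 : Cardinal.{u}) ^ κ ≤ 2 ^ Cardinal.aleph κ.ord :=
    power_le_power_left two_ne_zero hκl.le
  have hinf : ℵ₀ ≤ (2 : Cardinal.{u}) ^ Cardinal.aleph κ.ord := hl.trans (cantor _).le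
  have hX : #((I → Bool) ⊕ D) = 2 ^ Cardinal.aleph κ.ord := by
    rw [mk_sum, lift_id, lift_id, mk_arrow, lift_uzero, hI, hD, mk_bool, lift_ofNat]
    exact add_eq_left hinf ((cantor κ).le.trans hpow)
  have := normalSpace_sum_discrete (I → Bool) D
  have := weaklyLocallyCompactSpace_sum_discrete (I → Bool) D
  refine ⟨(I → Bool) ⊕ D, inferInstance, inferInstance, T4Space.mk, ?_, hX,
    isCaliberStar_sum_of_isCaliber hl (isCaliber_cantor_cube hκ hκl h2 I) (hD.symm ▸ h1),
    not_isWeakPrecaliber_sum_discrete _ D _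
      (fun a => aleph_lt_aleph.2 (Ordinal.typein_lt_self a))
      (aleph_pos _).ne' (sum_aleph_typein hκ), ?_⟩
  · refine le_antisymm ((oCard_sum_le _ D).trans ?_) (hX ▸ mk_le_oCard _)
    refine mul_le_of_le hinf ?_ (hD ▸ hpow)
    exact (mk_isOpen_cantor_cube_le I).trans_eq (by rw [hI])
  · simpa only [hD] using not_isWeakPrecaliberStar_sum_discrete (I → Bool) D (hD ▸ hκ)
end

section
/- Let X be a countably infinite T₁ topological space. Then an infinite cardinal λ is a caliber for X if and only if cf(λ) > ω; moreover, every caliber for X is a caliber* for X, and every caliber* for X is uncountable. -/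
open Cardinal Set

universe u

/-- A countably infinite T₁ space carries an injective sequence of non-empty open sets such that
every point lies in only finitely many of them. -/
theorem exists_pointFinite_open_seq (X : Type u) [TopologicalSpace X] [T1Space X]
    (hX : #X = ℵ₀) :
    ∃ U : ℕ → Set X, Function.Injective U ∧ (∀ n, IsOpen (U n)) ∧ (∀ n, (U n).Nonempty) ∧
      ∀ x, ∃ m, ∀ n, x ∈ U n → n ≤ m := by
  obtain ⟨_⟩ := Cardinal.denumerable_iff.2 hX
  let e : X ≃ ℕ := Denumerable.eqv X
  refine ⟨fun n => {x | n ≤ e x}, fun m n h => ?_, fun n => ?_, fun n => ⟨e.symm n, by simp⟩,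
    fun x => ⟨e x, fun n hn => hn⟩⟩
  · have key : ∀ k, m ≤ k ↔ n ≤ k := fun k => by
      simpa using Set.ext_iff.1 h (e.symm k)
    exact le_antisymm ((key n).2 le_rfl) ((key m).1 le_rfl)
  · have hfin : (e ⁻¹' Iio n).Finite := (finite_Iio n).preimage e.injective.injOn
    convert hfin.isClosed.isOpen_compl using 1
    ext x
    simp

/-- An infinite cardinal of countable cofinality is the increasing union of countably many sets
of smaller cardinality. -/
theorem exists_nat_rank_of_cof_le_aleph0 {c : Cardinal.{u}} (hc : ℵ₀ ≤ c)
    (hcof : c.ord.cof ≤ ℵ₀) :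
    ∃ f : c.ord.ToType → ℕ, ∀ n, #{a | f a ≤ n} < c := by
  obtain ⟨s, hs, hcard⟩ := Order.exists_cof_eq c.ord.ToType
  rw [Ordinal.cof_toType] at hcard
  have : Countable s := Cardinal.mk_le_aleph0_iff.1 (hcard.trans_le hcof)
  obtain ⟨e, he⟩ := exists_injective_nat s
  choose g hgs hg using hs
  refine ⟨fun a => e ⟨g a, hgs a⟩, fun n => ?_⟩
  have : Nonempty c.ord.ToType := by
    rw [← Cardinal.mk_ne_zero_iff, Cardinal.mk_ord_toType]
    exact (Cardinal.aleph0_pos.trans_le hc).ne'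
  have hfin : (Subtype.val '' (e ⁻¹' Iic n) : Set c.ord.ToType).Finite :=
    ((finite_Iic n).preimage he.injOn).image _
  obtain ⟨b, hb⟩ := hfin.bddAbove
  have hsub : {a | e ⟨g a, hgs a⟩ ≤ n} ⊆ Iic b := fun a ha =>
    (hg a).trans (hb ⟨⟨g a, hgs a⟩, ha, rfl⟩)
  refine (Cardinal.mk_le_mk_of_subset hsub).trans_lt ?_
  have hlt := Cardinal.mk_Iic_lt b (by simp) (by simpa using hc)
  rwa [Cardinal.mk_ord_toType] at hlt

/-- A cardinal whose cofinality exceeds the size of the space is a caliber. -/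
theorem isCaliber_of_mk_lt_cof (X : Type u) [TopologicalSpace X] {c : Cardinal.{u}}
    (hc : ℵ₀ ≤ c) (h : #X < c.ord.cof) : IsCaliber X c := by
  rintro ι U rfl - hne
  choose p hp using hne
  obtain ⟨x, hx⟩ := Cardinal.infinite_pigeonhole p hc h
  exact ⟨p ⁻¹' {x}, hx, x, mem_iInter₂.2 fun i hi => (show p i = x from hi) ▸ hp i⟩

theorem IsCaliber.aleph0_lt_cof {X : Type u} [TopologicalSpace X] [T1Space X] (hX : #X = ℵ₀)
    {c : Cardinal.{u}} (hc : ℵ₀ ≤ c) (h : IsCaliber X c) : ℵ₀ < c.ord.cof := by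
  by_contra! hcof
  obtain ⟨U, -, hopen, hne, hfin⟩ := exists_pointFinite_open_seq X hX
  obtain ⟨f, hf⟩ := exists_nat_rank_of_cof_le_aleph0 hc hcof
  obtain ⟨J, hJ, x, hx⟩ :=
    h (fun a => U (f a)) (Cardinal.mk_ord_toType c) (fun _ => hopen _) (fun _ => hne _)
  obtain ⟨m, hm⟩ := hfin x
  have hsub : J ⊆ {a | f a ≤ m} := fun a ha => hm _ (mem_iInter₂.1 hx a ha)
  exact ((Cardinal.mk_le_mk_of_subset hsub).trans_lt (hf m)).ne hJ

theorem IsCaliber.isCaliberStar {X : Type u} [TopologicalSpace X] {c : Cardinal.{u}}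
    (h : IsCaliber X c) : IsCaliberStar X c := by
  intro 𝒰 hcard hopen hne
  obtain ⟨J, hJ, x, hx⟩ :=
    h (fun V : 𝒰 => (V : Set X)) hcard (fun V => hopen V V.2) (fun V => hne V V.2)
  refine ⟨Subtype.val '' J, Subtype.coe_image_subset _ _, ?_, x, ?_⟩
  · rw [Cardinal.mk_image_eq Subtype.val_injective, hJ]
  · rintro _ ⟨V, hV, rfl⟩
    exact mem_iInter₂.1 hx V hV

theorem not_isCaliberStar_aleph0 {X : Type u} [TopologicalSpace X] [T1Space X]
    (hX : #X = ℵ₀) : ¬ IsCaliberStar X ℵ₀ := by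
  intro h
  obtain ⟨U, hinj, hopen, hne, hfin⟩ := exists_pointFinite_open_seq X hX
  have hcard : #(range U) = ℵ₀ := by simpa using Cardinal.mk_range_eq_of_injective hinj
  obtain ⟨𝒱, h𝒱, hcard𝒱, x, hx⟩ :=
    h (range U) hcard (forall_mem_range.2 hopen) (forall_mem_range.2 hne)
  obtain ⟨m, hm⟩ := hfin x
  have hsub : 𝒱 ⊆ U '' Iic m := by
    intro V hV
    obtain ⟨n, rfl⟩ := h𝒱 hV
    exact ⟨n, hm n (hx _ hV), rfl⟩
  exact (Cardinal.lt_aleph0_iff_set_finite.2 (((finite_Iic m).image U).subset hsub)).ne hcard𝒱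

theorem stmt13 (X : Type u) [TopologicalSpace X] [T1Space X] (hX : #X = ℵ₀)
    (lam : Cardinal.{u}) (hlam : ℵ₀ ≤ lam) :
    (IsCaliber X lam ↔ ℵ₀ < lam.ord.cof) ∧
    (IsCaliber X lam → IsCaliberStar X lam) ∧
    (IsCaliberStar X lam → ℵ₀ < lam) := by
  refine ⟨⟨fun h => h.aleph0_lt_cof hX hlam, fun h => isCaliber_of_mk_lt_cof X hlam (hX ▸ h)⟩,
    fun h => h.isCaliberStar, fun h => hlam.lt_of_ne ?_⟩
  rintro rfl
  exact not_isCaliberStar_aleph0 hX h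
end
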